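/- Let m ≥ 2 and let K ⊆ ℝ^m be a convex body. Then there exists a continuous map f : ℝP^m → S^m with the following property: for every integer k ≥ 2, if f admits a k-multiplicity, then there exist k pairwise distinct affine hyperplanes H_1, …, H_k in ℝ^m, each meeting the interior of K, such that m(H_1) = ⋯ = m(H_k). -/

import Mathlib

open MeasureTheory RealInnerProductSpace

/-- The projectivization of a topological vector space carries the quotient topology
coming from the nonzero vectors. -/
instance projectivizationTopology (K V : Type*) [DivisionRing K] [AddCommGroup V]
    [Module K V] [TopologicalSpace V] : TopologicalSpace (Projectivization K V) :=
  inferInstanceAs (TopologicalSpace (Quotient (projectivizationSetoid K V)))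

/-- The center of mass of `K ∩ H` with respect to `(m-1)`-dimensional Hausdorff measure. -/
noncomputable def centerOfMass (m : ℕ) (K H : Set (EuclideanSpace ℝ (Fin m))) :
    EuclideanSpace ℝ (Fin m) :=
  ((μH[(m : ℝ) - 1] (K ∩ H)).toReal)⁻¹ • ∫ x in K ∩ H, x ∂(μH[(m : ℝ) - 1])

/-- `H` is an affine hyperplane in `ℝ^m`. -/
def IsAffineHyperplane {m : ℕ} (H : Set (EuclideanSpace ℝ (Fin m))) : Prop :=
  ∃ w : EuclideanSpace ℝ (Fin m), w ≠ 0 ∧ ∃ t : ℝ, H = {x | ⟪x, w⟫ = t}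

open Set Filter Topology Metric Module

lemma abs_div_norm_add_abs_lt_one {E : Type*} [NormedAddCommGroup E] {u : E} (hu : u ≠ 0)
    (t : ℝ) : |t / (‖u‖ + |t|)| < 1 := by
  have hu' : 0 < ‖u‖ := norm_pos_iff.2 hu
  have h : 0 < ‖u‖ + |t| := by positivity
  rw [abs_div, abs_of_pos h, div_lt_one h]
  linarith

section HyperplaneSections

variable {E : Type*} [NormedAddCommGroup E] [InnerProductSpace ℝ E]

/-- The affine hyperplane `{x | ⟪x, u⟫ = c}`. -/
def levelHyperplane (u : E) (c : ℝ) : Set E := {x | ⟪x, u⟫ = c}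

/-- A parametrization of the hyperplane `levelHyperplane u c` by the orthogonal complement of a
fixed unit vector `v`. -/
noncomputable def hyperplaneChart (v u : E) (c : ℝ) (y : (ℝ ∙ v)ᗮ) : E :=
  (ℝ ∙ (u + ‖u‖ • v)).reflection (y + (c / ‖u‖) • v)

lemma isometry_hyperplaneChart (v u : E) (c : ℝ) : Isometry (hyperplaneChart v u c) :=
  (LinearIsometryEquiv.isometry _).comp
    ((IsometryEquiv.addRight ((c / ‖u‖) • v)).isometry.comp isometry_subtype_coe)

lemma inner_reflection_add_norm_smul {v u : E} (hv : ‖v‖ = 1) (h : u + ‖u‖ • v ≠ 0) (x : E) :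
    ⟪(ℝ ∙ (u + ‖u‖ • v)).reflection x, u⟫ = ‖u‖ * ⟪x, v⟫ := by
  have hw : ‖u + ‖u‖ • v‖ ^ 2 = 2 * ⟪u + ‖u‖ • v, u⟫ := by
    rw [← real_inner_self_eq_norm_sq]
    simp only [inner_add_left, inner_add_right, inner_smul_left, inner_smul_right,
      real_inner_self_eq_norm_sq, hv, real_inner_comm u v]
    simp
    ring
  have h0 : ‖u + ‖u‖ • v‖ ^ 2 ≠ 0 := by simpa using h
  rw [Submodule.reflection_singleton_apply, inner_sub_left, ← Nat.cast_smul_eq_nsmul ℝ,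
    inner_smul_left, inner_smul_left]
  have h1 : ⟪u + ‖u‖ • v, x⟫ = ⟪x, u⟫ + ‖u‖ * ⟪x, v⟫ := by
    rw [inner_add_left, inner_smul_left, real_inner_comm, real_inner_comm x v]; simp
  have h2 : ⟪u + ‖u‖ • v, u⟫ = ‖u + ‖u‖ • v‖ ^ 2 / 2 := by rw [hw]; ring
  rw [h1, h2]
  simp only [Nat.cast_ofNat, conj_trivial, RCLike.ofReal_real_eq_id, id_eq]
  field_simp
  ring

lemma range_hyperplaneChart {v u : E} (hv : ‖v‖ = 1) (hu : u ≠ 0) (h : u + ‖u‖ • v ≠ 0) (c : ℝ) :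
    range (hyperplaneChart v u c) = levelHyperplane u c := by
  have hu' : ‖u‖ ≠ 0 := norm_ne_zero_iff.2 hu
  ext z
  constructor
  · rintro ⟨y, rfl⟩
    have hy : ⟪(y : E), v⟫ = 0 := by
      rw [real_inner_comm]; exact Submodule.mem_orthogonal_singleton_iff_inner_right.1 y.2
    simp only [levelHyperplane, hyperplaneChart, mem_ofPred_eq]
    rw [inner_reflection_add_norm_smul hv h, inner_add_left, hy, inner_smul_left,
      real_inner_self_eq_norm_sq, hv]
    simp
    field_simp
  · intro hz
    set x := (ℝ ∙ (u + ‖u‖ • v)).reflection z with hx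
    have hzx : (ℝ ∙ (u + ‖u‖ • v)).reflection x = z := Submodule.reflection_reflection _ _
    have h1 := inner_reflection_add_norm_smul hv h x
    rw [hzx, show ⟪z, u⟫ = c from hz] at h1
    refine ⟨⟨x - (c / ‖u‖) • v, ?_⟩, by simp [hyperplaneChart, hzx]⟩
    rw [Submodule.mem_orthogonal_singleton_iff_inner_right, real_inner_comm, inner_sub_left,
      inner_smul_left, real_inner_self_eq_norm_sq, hv]
    simp
    field_simp
    linarith

lemma continuousAt_hyperplaneChart {v : E} (y : (ℝ ∙ v)ᗮ) {p : E × ℝ} (hp : p.1 ≠ 0)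
    (h : p.1 + ‖p.1‖ • v ≠ 0) :
    ContinuousAt (fun q : E × ℝ ↦ hyperplaneChart v q.1 q.2 y) p := by
  have hu' : ‖p.1‖ ≠ 0 := norm_ne_zero_iff.2 hp
  have h0 : ‖p.1 + ‖p.1‖ • v‖ ^ 2 ≠ 0 := by simpa using h
  simp only [hyperplaneChart, Submodule.reflection_singleton_apply]
  simp only [RCLike.ofReal_real_eq_id, id_eq]
  fun_prop (disch := assumption)

lemma norm_le_norm_hyperplaneChart (v u : E) (c : ℝ) (y : (ℝ ∙ v)ᗮ) :
    ‖y‖ ≤ ‖hyperplaneChart v u c y‖ := by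
  rw [hyperplaneChart, LinearIsometryEquiv.norm_map]
  have hy : ⟪(y : E), v⟫ = 0 := by
    rw [real_inner_comm]; exact Submodule.mem_orthogonal_singleton_iff_inner_right.1 y.2
  have := norm_add_sq_real (y : E) ((c / ‖u‖) • v)
  rw [inner_smul_right, hy] at this
  refine le_of_sq_le_sq ?_ (norm_nonneg _)
  rw [this, Submodule.coe_norm]
  nlinarith [sq_nonneg ‖(c / ‖u‖) • v‖]

lemma hyperplaneChart_combo (v u : E) (c : ℝ) (y z : (ℝ ∙ v)ᗮ) {a b : ℝ} (hab : a + b = 1) :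
    hyperplaneChart v u c (a • y + b • z) =
      a • hyperplaneChart v u c y + b • hyperplaneChart v u c z := by
  simp only [hyperplaneChart, ← map_smul, ← map_add]
  congr 1
  obtain rfl : b = 1 - a := by linarith
  simp
  module

lemma Convex.preimage_hyperplaneChart {s : Set E} (hs : Convex ℝ s) (v u : E) (c : ℝ) :
    Convex ℝ (hyperplaneChart v u c ⁻¹' s) := by
  intro y hy z hz a b ha hb hab
  rw [mem_preimage, hyperplaneChart_combo v u c y z hab]
  exact hs hy hz ha hb hab

lemma preimage_frontier_hyperplaneChart_subset {K : Set E} (hK : Convex ℝ K) (hKc : IsClosed K)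
    (v u : E) (c : ℝ) (hne : (range (hyperplaneChart v u c) ∩ interior K).Nonempty) :
    hyperplaneChart v u c ⁻¹' frontier K ⊆ frontier (hyperplaneChart v u c ⁻¹' interior K) := by
  obtain ⟨_, ⟨p, rfl⟩, hp⟩ := hne
  have hcont := (isometry_hyperplaneChart v u c).continuous
  intro y hy
  rw [mem_preimage, hKc.frontier_eq] at hy
  rw [(isOpen_interior.preimage hcont).frontier_eq]
  refine ⟨?_, hy.2⟩
  have hsub : openSegment ℝ p y ⊆ hyperplaneChart v u c ⁻¹' interior K := by
    rintro _ ⟨a, b, ha, hb, hab, rfl⟩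
    rw [mem_preimage, hyperplaneChart_combo v u c p y hab]
    exact hK.combo_interior_self_mem_interior hp hy.1 ha hb.le hab
  exact closure_mono hsub (segment_subset_closure_openSegment (right_mem_segment ℝ p y))
lemma isClosed_levelHyperplane (u : E) (c : ℝ) : IsClosed (levelHyperplane u c) :=
  isClosed_eq (by fun_prop) continuous_const

lemma convex_levelHyperplane (u : E) (c : ℝ) : Convex ℝ (levelHyperplane u c) := by
  intro x hx y hy a b _ _ hab
  simp only [levelHyperplane, mem_ofPred_eq] at hx hy ⊢
  rw [inner_add_left, inner_smul_left, inner_smul_left, hx, hy, ← add_mul]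
  simp [hab]

lemma add_norm_smul_normalize_ne_zero {u : E} (hu : u ≠ 0) :
    u + ‖u‖ • ((‖u‖⁻¹ : ℝ) • u) ≠ 0 := by
  rw [smul_smul, mul_inv_cancel₀ (norm_ne_zero_iff.2 hu), one_smul, ← two_smul ℝ]
  simpa using hu

section Measure

variable [MeasurableSpace E] [BorelSpace E] {d : ℝ}

lemma hausdorffMeasure_inter_levelHyperplane {u : E} {c : ℝ} (hd : 0 ≤ d) (hu : u ≠ 0) (S : Set E) :
    μH[d] (S ∩ levelHyperplane u c) =
      μH[d] (hyperplaneChart ((‖u‖⁻¹ : ℝ) • u) u c ⁻¹' S) := by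
  have h := add_norm_smul_normalize_ne_zero hu
  rw [← range_hyperplaneChart (norm_smul_inv_norm (𝕜 := ℝ) hu) hu h]
  exact ((isometry_hyperplaneChart _ u c).hausdorffMeasure_preimage (.inl hd) S).symm

variable [FiniteDimensional ℝ E]

lemma isAddHaarMeasure_hausdorffMeasure_orthogonal {v : E} (hv : v ≠ 0)
    (hd : d + 1 = finrank ℝ E) : (μH[d] : Measure (ℝ ∙ v)ᗮ).IsAddHaarMeasure := by
  have h := (ℝ ∙ v).finrank_add_finrank_orthogonal
  rw [finrank_span_singleton hv] at h
  obtain rfl : d = (finrank ℝ (ℝ ∙ v)ᗮ : ℝ) := by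
    rw [← h] at hd; push_cast at hd; linarith
  infer_instance

lemma setIntegral_inter_levelHyperplane {F : Type*} [NormedAddCommGroup F] [NormedSpace ℝ F]
    {K : Set E} (hK : MeasurableSet K) {v u : E} {c : ℝ} (hd : 0 ≤ d) (hv : ‖v‖ = 1) (hu : u ≠ 0)
    (h : u + ‖u‖ • v ≠ 0) (g : E → F) :
    ∫ x in K ∩ levelHyperplane u c, g x ∂μH[d] =
      ∫ y, K.indicator g (hyperplaneChart v u c y) ∂μH[d] := by
  have hiso := isometry_hyperplaneChart v u c
  have hemb : MeasurableEmbedding (hyperplaneChart v u c) :=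
    hiso.isClosedEmbedding.measurableEmbedding
  rw [← range_hyperplaneChart hv hu h, ← Measure.restrict_restrict hK,
    ← hiso.map_hausdorffMeasure (.inl hd), hemb.setIntegral_map,
    ← integral_indicator (hemb.measurable hK)]
  rfl

lemma hausdorffMeasure_inter_levelHyperplane_pos {u : E} {c : ℝ} (hd : d + 1 = finrank ℝ E) (hd0 : 0 ≤ d)
    (hu : u ≠ 0) {U : Set E} (hU : IsOpen U) (hne : (U ∩ levelHyperplane u c).Nonempty) :
    0 < μH[d] (U ∩ levelHyperplane u c) := by
  have h := add_norm_smul_normalize_ne_zero hu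
  have := isAddHaarMeasure_hausdorffMeasure_orthogonal (v := (‖u‖⁻¹ : ℝ) • u) (by simpa) hd
  rw [hausdorffMeasure_inter_levelHyperplane hd0 hu]
  refine (hU.preimage (isometry_hyperplaneChart _ u c).continuous).measure_pos _ ?_
  obtain ⟨x, hx, hx'⟩ := hne
  rw [← range_hyperplaneChart (norm_smul_inv_norm (𝕜 := ℝ) hu) hu h] at hx'
  obtain ⟨y, rfl⟩ := hx'
  exact ⟨y, hx⟩

lemma hausdorffMeasure_inter_levelHyperplane_lt_top {u : E} {c : ℝ} (hd : d + 1 = finrank ℝ E) (hd0 : 0 ≤ d)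
    (hu : u ≠ 0) {K : Set E} (hK : IsCompact K) : μH[d] (K ∩ levelHyperplane u c) < ⊤ := by
  have := isAddHaarMeasure_hausdorffMeasure_orthogonal (v := (‖u‖⁻¹ : ℝ) • u) (by simpa) hd
  rw [hausdorffMeasure_inter_levelHyperplane hd0 hu]
  exact ((isometry_hyperplaneChart _ u c).isClosedEmbedding.isCompact_preimage hK).measure_lt_top

lemma continuousAt_setIntegral_inter_levelHyperplane {F : Type*} [NormedAddCommGroup F]
    [NormedSpace ℝ F] {K : Set E} (hK : IsCompact K) (hKconv : Convex ℝ K)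
    (hd : d + 1 = finrank ℝ E) (hd0 : 0 ≤ d) {p : E × ℝ} (hp : p.1 ≠ 0)
    (hne : (levelHyperplane p.1 p.2 ∩ interior K).Nonempty) {g : E → F} (hg : Continuous g) :
    ContinuousAt (fun q : E × ℝ ↦ ∫ x in K ∩ levelHyperplane q.1 q.2, g x ∂μH[d]) p := by
  set v : E := (‖p.1‖⁻¹ : ℝ) • p.1 with hvdef
  have hv : ‖v‖ = 1 := norm_smul_inv_norm (𝕜 := ℝ) hp
  have hp' : p.1 + ‖p.1‖ • v ≠ 0 := add_norm_smul_normalize_ne_zero hp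
  have hμ := isAddHaarMeasure_hausdorffMeasure_orthogonal (v := v) (by simpa [hvdef]) hd
  have hev : ∀ᶠ q : E × ℝ in 𝓝 p, q.1 ≠ 0 ∧ q.1 + ‖q.1‖ • v ≠ 0 :=
    (continuousAt_fst.eventually_ne hp).and (ContinuousAt.eventually_ne (by fun_prop) hp')
  have heq : ∀ᶠ q : E × ℝ in 𝓝 p, ∫ x in K ∩ levelHyperplane q.1 q.2, g x ∂μH[d] =
      ∫ y, K.indicator g (hyperplaneChart v q.1 q.2 y) ∂μH[d] :=
    hev.mono fun q hq ↦ setIntegral_inter_levelHyperplane hK.measurableSet hd0 hv hq.1 hq.2 g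
  refine ContinuousAt.congr ?_ (heq.mono fun q hq ↦ hq.symm)
  obtain ⟨R, hR⟩ := hK.isBounded.subset_closedBall (0 : E)
  obtain ⟨C, hC⟩ := hK.exists_bound_of_continuousOn hg.continuousOn
  refine tendsto_integral_filter_of_dominated_convergence
    ((closedBall (0 : (ℝ ∙ v)ᗮ) R).indicator fun _ ↦ |C|) (.of_forall fun q ↦ ?_)
    (.of_forall fun q ↦ .of_forall fun y ↦ ?_) ?_ ?_
  · exact ((hg.stronglyMeasurable.indicator hK.measurableSet).comp_measurable
      (isometry_hyperplaneChart v q.1 q.2).continuous.measurable).aestronglyMeasurable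
  · by_cases hy : hyperplaneChart v q.1 q.2 y ∈ K
    · have hyR : y ∈ closedBall (0 : (ℝ ∙ v)ᗮ) R := by
        have := hR hy
        rw [mem_closedBall_zero_iff] at this ⊢
        exact (norm_le_norm_hyperplaneChart _ _ _ _).trans this
      rw [indicator_of_mem hy, indicator_of_mem hyR]
      exact (hC _ hy).trans (le_abs_self C)
    · rw [indicator_of_notMem hy, norm_zero]
      exact indicator_nonneg (fun _ _ ↦ abs_nonneg C) _
  · exact (integrableOn_const (isCompact_closedBall _ _).measure_lt_top.ne).integrable_indicator
      measurableSet_closedBall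
  · have hfr : ∀ᵐ y : (ℝ ∙ v)ᗮ ∂μH[d], hyperplaneChart v p.1 p.2 y ∉ frontier K := by
      rw [← range_hyperplaneChart hv hp hp'] at hne
      have hsub := preimage_frontier_hyperplaneChart_subset hKconv hK.isClosed _ _ _ hne
      refine measure_mono_null (fun y hy ↦ hsub (not_not.1 hy))
        ((hKconv.interior.preimage_hyperplaneChart _ _ _).addHaar_frontier μH[d])
    filter_upwards [hfr] with y hy
    have hcont : ContinuousAt (K.indicator g) (hyperplaneChart v p.1 p.2 y) :=
      hg.continuousOn.continuousAt_indicator hy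
    exact hcont.comp_of_eq (continuousAt_hyperplaneChart y hp hp') rfl

/-- The center of mass of `K ∩ H` with respect to the `d`-dimensional Hausdorff measure. -/
noncomputable def sectionCentroid (d : ℝ) (K H : Set E) : E :=
  (μH[d] (K ∩ H)).toReal⁻¹ • ∫ x in K ∩ H, x ∂μH[d]

lemma continuousAt_sectionCentroid {K : Set E} (hK : IsCompact K) (hKconv : Convex ℝ K)
    (hd : d + 1 = finrank ℝ E) (hd0 : 0 ≤ d) {p : E × ℝ} (hp : p.1 ≠ 0)
    (hne : (levelHyperplane p.1 p.2 ∩ interior K).Nonempty) :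
    ContinuousAt (fun q : E × ℝ ↦ sectionCentroid d K (levelHyperplane q.1 q.2)) p := by
  have h1 := continuousAt_setIntegral_inter_levelHyperplane hK hKconv hd hd0 hp hne
    (continuous_const (y := (1 : ℝ)))
  simp only [integral_const, smul_eq_mul, mul_one, measureReal_restrict_apply_univ] at h1
  have hpos : μH[d] (K ∩ levelHyperplane p.1 p.2) ≠ 0 :=
    ((hausdorffMeasure_inter_levelHyperplane_pos hd hd0 hp isOpen_interior
      (inter_comm _ _ ▸ hne)).trans_le
        (measure_mono (inter_subset_inter_left _ interior_subset))).ne'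
  refine (h1.inv₀ ?_).smul
    (continuousAt_setIntegral_inter_levelHyperplane hK hKconv hd hd0 hp hne continuous_id)
  exact ENNReal.toReal_ne_zero.2
    ⟨hpos, (hausdorffMeasure_inter_levelHyperplane_lt_top hd hd0 hp hK).ne⟩

lemma sectionCentroid_mem {K : Set E} (hK : IsCompact K) (hKconv : Convex ℝ K)
    (hd : d + 1 = finrank ℝ E) (hd0 : 0 ≤ d) {u : E} {c : ℝ} (hu : u ≠ 0)
    (hne : (levelHyperplane u c ∩ interior K).Nonempty) :
    sectionCentroid d K (levelHyperplane u c) ∈ levelHyperplane u c ∩ interior K := by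
  set H := levelHyperplane u c
  have hH : IsClosed H := isClosed_levelHyperplane u c
  have hpos : ∀ {U : Set E}, IsOpen U → (U ∩ H).Nonempty → μH[d] (U ∩ H) ≠ 0 := fun hU h ↦
    (hausdorffMeasure_inter_levelHyperplane_pos hd hd0 hu hU h).ne'
  have hfin : ∀ {S : Set E}, IsCompact S → μH[d] (S ∩ H) < ⊤ := fun hS ↦
    hausdorffMeasure_inter_levelHyperplane_lt_top hd hd0 hu hS
  have hKpos : μH[d] (K ∩ H) ≠ 0 := fun h ↦ hpos isOpen_interior (inter_comm _ _ ▸ hne)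
    (measure_mono_null (inter_subset_inter_left _ interior_subset) h)
  have hmeas : MeasurableSet (K ∩ H) := (hK.isClosed.inter hH).measurableSet
  have hfinite : IsFiniteMeasure ((μH[d] : Measure E).restrict (K ∩ H)) :=
    ⟨by simpa using hfin hK⟩
  have hnz : NeZero ((μH[d] : Measure E).restrict (K ∩ H)) := ⟨by simpa using hKpos⟩
  have hint : Integrable (fun x : E ↦ x) (μH[d].restrict (K ∩ H)) := by
    obtain ⟨C, hC⟩ := hK.exists_bound_of_continuousOn continuousOn_id
    exact .of_bound continuous_id.aestronglyMeasurable C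
      ((ae_restrict_mem hmeas).mono fun x hx ↦ hC x hx.1)
  have havg : sectionCentroid d K H = ⨍ x in K ∩ H, x ∂μH[d] := by
    rw [setAverage_eq]; rfl
  rw [havg]
  refine ⟨(convex_levelHyperplane u c).average_mem hH
    ((ae_restrict_mem hmeas).mono fun x hx ↦ hx.2) hint, ?_⟩
  obtain ⟨p, hpH, hpK⟩ := hne
  obtain ⟨r, hr, hrK⟩ := nhds_basis_closedBall.mem_iff.1 (isOpen_interior.mem_nhds hpK)
  have hball : (μH[d] : Measure E).restrict (K ∩ H) (closedBall p r) ≠ 0 := by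
    rw [Measure.restrict_apply measurableSet_closedBall]
    refine fun h ↦ hpos isOpen_ball ⟨p, mem_ball_self hr, hpH⟩ (measure_mono_null ?_ h)
    exact fun x hx ↦ ⟨ball_subset_closedBall hx.1,
      interior_subset (hrK (ball_subset_closedBall hx.1)), hx.2⟩
  refine hKconv.average_mem_interior_of_set hball
    ((ae_restrict_mem hmeas).mono fun x hx ↦ hx.1) hint (hrK ?_)
  exact (convex_closedBall p r).set_average_mem isClosed_closedBall hball (measure_ne_top _ _)
    (ae_restrict_mem measurableSet_closedBall) hint.integrableOn

end Measure

/-- The support function of `K`. -/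
noncomputable def supportFun (K : Set E) (u : E) : ℝ := sSup ((fun x ↦ ⟪x, u⟫) '' K)

lemma continuous_supportFun {K : Set E} (hK : IsCompact K) : Continuous (supportFun K) :=
  hK.continuous_sSup (f := fun u x ↦ ⟪x, u⟫) (by fun_prop)

lemma inner_le_supportFun {K : Set E} (hK : IsCompact K) {x : E} (hx : x ∈ K) (u : E) :
    ⟪x, u⟫ ≤ supportFun K u :=
  le_csSup (hK.image (f := fun x ↦ ⟪x, u⟫) (by fun_prop)).bddAbove (mem_image_of_mem _ hx)

lemma exists_inner_eq_supportFun {K : Set E} (hK : IsCompact K) (hne : K.Nonempty) (u : E) :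
    ∃ x ∈ K, ⟪x, u⟫ = supportFun K u :=
  (hK.image (f := fun x ↦ ⟪x, u⟫) (by fun_prop)).sSup_mem (hne.image _)

lemma supportFun_smul (K : Set E) {a : ℝ} (ha : 0 ≤ a) (u : E) :
    supportFun K (a • u) = a * supportFun K u := by
  rw [supportFun, supportFun, ← smul_eq_mul, ← Real.sSup_smul_of_nonneg ha, ← image_smul,
    image_image]
  simp [inner_smul_right]

lemma inner_lt_supportFun {K : Set E} (hK : IsCompact K) {x : E} (hx : x ∈ interior K) {u : E}
    (hu : u ≠ 0) : ⟪x, u⟫ < supportFun K u := by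
  have hcont : ContinuousAt (fun t : ℝ ↦ x + t • u) 0 := by fun_prop
  have hmem : ∀ᶠ t : ℝ in 𝓝[>] 0, x + t • u ∈ interior K :=
    (hcont.eventually (isOpen_interior.mem_nhds (by simpa using hx))).filter_mono
      nhdsWithin_le_nhds
  obtain ⟨t, ht, ht0⟩ := (hmem.and self_mem_nhdsWithin).exists
  have h := inner_le_supportFun hK (interior_subset ht) u
  rw [inner_add_left, inner_smul_left, real_inner_self_eq_norm_sq] at h
  have : 0 < t * ‖u‖ ^ 2 := mul_pos ht0 (by positivity)
  simp at h
  linarith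

lemma exists_mem_interior_lt_inner {K : Set E} (hK : IsCompact K) (hKconv : Convex ℝ K)
    (hne : (interior K).Nonempty) {u : E} {c : ℝ} (hc : c < supportFun K u) :
    ∃ x ∈ interior K, c < ⟪x, u⟫ := by
  obtain ⟨x, hx, hxu⟩ := exists_inner_eq_supportFun hK (hne.mono interior_subset) u
  have hopen : IsOpen {y : E | c < ⟪y, u⟫} := isOpen_lt continuous_const (by fun_prop)
  have hcl : x ∈ closure (interior K) := by
    rw [hKconv.closure_interior_eq_closure_of_nonempty_interior hne]; exact subset_closure hx
  obtain ⟨y, hy, hyK⟩ := mem_closure_iff.1 hcl _ hopen (by simpa [hxu] using hc)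
  exact ⟨y, hyK, hy⟩

lemma levelHyperplane_inter_interior_nonempty {K : Set E} (hK : IsCompact K)
    (hKconv : Convex ℝ K) (hne : (interior K).Nonempty) {u : E} {c : ℝ}
    (h1 : -supportFun K (-u) < c) (h2 : c < supportFun K u) :
    (levelHyperplane u c ∩ interior K).Nonempty := by
  obtain ⟨x, hx, hxc⟩ := exists_mem_interior_lt_inner hK hKconv hne h2
  obtain ⟨y, hy, hyc⟩ := exists_mem_interior_lt_inner hK hKconv hne (neg_lt.1 h1)
  rw [inner_neg_right] at hyc
  obtain ⟨z, hz, hzc⟩ := hKconv.interior.isPreconnected.intermediate_value hy hx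
    (f := fun x ↦ ⟪x, u⟫) (by fun_prop) ⟨by linarith, hxc.le⟩
  exact ⟨z, hzc, hz⟩

/-- A point of the open interval of offsets `c` for which `levelHyperplane u c` meets the interior
of `K`, depending homogeneously on `(u, t)`. -/
noncomputable def sectionOffset (K : Set E) (u : E) (t : ℝ) : ℝ :=
  supportFun K u * ((1 + t / (‖u‖ + |t|)) / 2) - supportFun K (-u) * ((1 - t / (‖u‖ + |t|)) / 2)

lemma supportFun_add_supportFun_neg_pos {K : Set E} (hK : IsCompact K) (hne : (interior K).Nonempty)
    {u : E} (hu : u ≠ 0) : 0 < supportFun K u + supportFun K (-u) := by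
  obtain ⟨x, hx⟩ := hne
  have h1 := inner_lt_supportFun hK hx hu
  have h2 := inner_lt_supportFun hK hx (neg_ne_zero.2 hu)
  rw [inner_neg_right] at h2
  linarith

lemma supportFun_sub_sectionOffset (K : Set E) (u : E) (t : ℝ) :
    supportFun K u - sectionOffset K u t =
      (supportFun K u + supportFun K (-u)) * ((1 - t / (‖u‖ + |t|)) / 2) := by
  rw [sectionOffset]; ring

lemma sectionOffset_neg (K : Set E) (u : E) (t : ℝ) :
    sectionOffset K (-u) (-t) = -sectionOffset K u t := by
  simp only [sectionOffset, norm_neg, abs_neg, neg_neg, neg_div]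
  ring

lemma sectionOffset_smul_of_pos (K : Set E) (u : E) (t : ℝ) {a : ℝ} (ha : 0 < a) :
    sectionOffset K (a • u) (a * t) = a * sectionOffset K u t := by
  have h : a * t / (‖a • u‖ + |a * t|) = t / (‖u‖ + |t|) := by
    rw [norm_smul, abs_mul, Real.norm_eq_abs, abs_of_pos ha, ← mul_add,
      mul_div_mul_left _ _ ha.ne']
  rw [sectionOffset, h, ← smul_neg, supportFun_smul K ha.le, supportFun_smul K ha.le, sectionOffset]
  ring

lemma sectionOffset_smul (K : Set E) (u : E) (t : ℝ) {a : ℝ} (ha : a ≠ 0) :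
    sectionOffset K (a • u) (a * t) = a * sectionOffset K u t := by
  rcases ha.lt_or_gt with h | h
  · have := sectionOffset_smul_of_pos K u t (neg_pos.2 h)
    rw [neg_smul, neg_mul, sectionOffset_neg] at this
    linarith
  · exact sectionOffset_smul_of_pos K u t h

lemma levelHyperplane_sectionOffset_inter_interior_nonempty {K : Set E} (hK : IsCompact K)
    (hKconv : Convex ℝ K) (hne : (interior K).Nonempty) {u : E} (hu : u ≠ 0) (t : ℝ) :
    (levelHyperplane u (sectionOffset K u t) ∩ interior K).Nonempty := by
  have hw := supportFun_add_supportFun_neg_pos hK hne hu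
  obtain ⟨h1, h2⟩ := abs_lt.1 (abs_div_norm_add_abs_lt_one hu t)
  refine levelHyperplane_inter_interior_nonempty hK hKconv hne ?_ ?_ <;>
  · rw [sectionOffset]
    nlinarith

lemma sectionOffset_injective {K : Set E} (hK : IsCompact K) (hne : (interior K).Nonempty)
    {u : E} (hu : u ≠ 0) : Function.Injective (sectionOffset K u) := by
  intro t s h
  have hw := supportFun_add_supportFun_neg_pos hK hne hu
  have hu' : 0 < ‖u‖ := norm_pos_iff.2 hu
  have h1 := supportFun_sub_sectionOffset K u t
  rw [h, supportFun_sub_sectionOffset] at h1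
  have h2 : t / (‖u‖ + |t|) = s / (‖u‖ + |s|) := by
    have := mul_left_cancel₀ hw.ne' h1
    linarith
  rw [div_eq_div_iff (by positivity) (by positivity)] at h2
  rcases abs_cases t with ⟨ht, ht'⟩ | ⟨ht, ht'⟩ <;> rcases abs_cases s with ⟨hs, hs'⟩ | ⟨hs, hs'⟩ <;>
    rw [ht, hs] at h2 <;> nlinarith

lemma continuousAt_sectionOffset {K : Set E} (hK : IsCompact K) {p : E × ℝ} (hp : p.1 ≠ 0) :
    ContinuousAt (fun q : E × ℝ ↦ sectionOffset K q.1 q.2) p := by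
  have hp' : 0 < ‖p.1‖ := norm_pos_iff.2 hp
  have h : ‖p.1‖ + |p.2| ≠ 0 := by positivity
  have hc := continuous_supportFun hK
  unfold sectionOffset
  fun_prop (disch := assumption)

lemma levelHyperplane_smul (u : E) (c : ℝ) {a : ℝ} (ha : a ≠ 0) :
    levelHyperplane (a • u) (a * c) = levelHyperplane u c := by
  ext x
  simp [levelHyperplane, inner_smul_right, ha]

lemma exists_smul_of_levelHyperplane_eq {u w : E} {b c : ℝ} (hu : u ≠ 0)
    (hne : (levelHyperplane u c).Nonempty) (h : levelHyperplane u c = levelHyperplane w b) :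
    ∃ a : ℝ, w = a • u ∧ b = a * c := by
  have hu' : ‖u‖ ^ 2 ≠ 0 := by simpa using hu
  obtain ⟨x, hx⟩ := hne
  have hxw : ⟪x, w⟫ = b := by rw [h] at hx; exact hx
  replace hx : ⟪x, u⟫ = c := hx
  set a := ⟪w, u⟫ / ‖u‖ ^ 2
  have hy : ⟪w - a • u, u⟫ = 0 := by
    rw [inner_sub_left, inner_smul_left, real_inner_self_eq_norm_sq]
    simp [a, div_mul_cancel₀ _ hu']
  have hyw : ⟪w - a • u, w⟫ = 0 := by
    have : x + (w - a • u) ∈ levelHyperplane w b := by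
      rw [← h]
      change ⟪x + (w - a • u), u⟫ = c
      rw [inner_add_left, hy, hx, add_zero]
    replace this : ⟪x + (w - a • u), w⟫ = b := this
    rw [inner_add_left, hxw] at this
    linarith
  have hwa : w = a • u := by
    rw [← sub_eq_zero, ← inner_self_eq_zero (𝕜 := ℝ)]
    rw [inner_sub_right (w - a • u), hyw, inner_smul_right, hy, mul_zero, sub_zero]
  exact ⟨a, hwa, by rw [← hxw, hwa, inner_smul_right, hx]⟩

/-- The hyperplane meeting the interior of `K` attached to the homogeneous coordinates `p`. -/
def sectionHyperplane (K : Set E) (p : E × ℝ) : Set E :=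
  levelHyperplane p.1 (sectionOffset K p.1 p.2)

lemma sectionHyperplane_smul (K : Set E) (p : E × ℝ) {a : ℝ} (ha : a ≠ 0) :
    sectionHyperplane K (a • p) = sectionHyperplane K p := by
  simp only [sectionHyperplane, Prod.smul_fst, Prod.smul_snd, smul_eq_mul]
  rw [sectionOffset_smul K _ _ ha, levelHyperplane_smul _ _ ha]

lemma exists_smul_of_sectionHyperplane_eq {K : Set E} (hK : IsCompact K) (hKconv : Convex ℝ K)
    (hne : (interior K).Nonempty) {p q : E × ℝ} (hp : p.1 ≠ 0) (hq : q.1 ≠ 0)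
    (h : sectionHyperplane K p = sectionHyperplane K q) : ∃ a : ℝ, a • p = q := by
  obtain ⟨a, ha, hab⟩ := exists_smul_of_levelHyperplane_eq hp
    (levelHyperplane_sectionOffset_inter_interior_nonempty hK hKconv hne hp p.2).left h
  have ha0 : a ≠ 0 := by rintro rfl; exact hq (by rw [ha, zero_smul])
  rw [← sectionOffset_smul K _ _ ha0, ← ha] at hab
  exact ⟨a, Prod.ext ha.symm (sectionOffset_injective hK hne hq hab).symm⟩

section Extension

variable [MeasurableSpace E] [BorelSpace E] {Y : Type*}

open Classical in
/-- The map sending homogeneous coordinates of a hyperplane section of `K` to the image under `Ψ`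
of its centroid, and the point at infinity to `N`. -/
noncomputable def centroidMap (d : ℝ) (K : Set E) (Ψ : E → Y) (N : Y) (p : E × ℝ) : Y :=
  if p.1 = 0 then N else Ψ (sectionCentroid d K (sectionHyperplane K p))

lemma centroidMap_smul (d : ℝ) (K : Set E) (Ψ : E → Y) (N : Y) (p : E × ℝ) {a : ℝ} (ha : a ≠ 0) :
    centroidMap d K Ψ N (a • p) = centroidMap d K Ψ N p := by
  by_cases hp : p.1 = 0 <;> simp [centroidMap, sectionHyperplane_smul K p ha, ha, hp]

variable [FiniteDimensional ℝ E]

lemma exists_hyperplanes_of_centroidMap_eq {K : Set E} (hK : IsCompact K) (hKconv : Convex ℝ K)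
    (hne : (interior K).Nonempty) {d : ℝ} (hd : d + 1 = finrank ℝ E) (hd0 : 0 ≤ d) {Ψ : E → Y} {N : Y}
    (hin : ∀ x ∈ interior K, Ψ x ≠ N) (hinj : InjOn Ψ (interior K)) {ι : Type*} [Nontrivial ι]
    {p : ι → E × ℝ} (hp : ∀ i j, i ≠ j → ∀ a : ℝ, a • p i ≠ p j) (hp0 : ∀ i, p i ≠ 0)
    (heq : ∀ i j, centroidMap d K Ψ N (p i) = centroidMap d K Ψ N (p j)) :
    (∀ i, (p i).1 ≠ 0) ∧ Function.Injective (fun i ↦ sectionHyperplane K (p i)) ∧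
      (∀ i, (sectionHyperplane K (p i) ∩ interior K).Nonempty) ∧
      ∀ i j, sectionCentroid d K (sectionHyperplane K (p i)) =
        sectionCentroid d K (sectionHyperplane K (p j)) := by
  have hmem : ∀ i, (p i).1 ≠ 0 →
      sectionCentroid d K (sectionHyperplane K (p i)) ∈ interior K := fun i hi ↦
    (sectionCentroid_mem hK hKconv hd hd0 hi
      (levelHyperplane_sectionOffset_inter_interior_nonempty hK hKconv hne hi (p i).2)).2
  have h0 : ∀ i, (p i).1 ≠ 0 := by
    intro i hi
    obtain ⟨j, hj⟩ := exists_ne i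
    have hij := heq j i
    by_cases hj0 : (p j).1 = 0
    · have h2 : (p i).2 ≠ 0 := fun h ↦ hp0 i (Prod.ext hi h)
      refine hp i j hj.symm ((p j).2 / (p i).2) (Prod.ext ?_ ?_)
      · simp [hi, hj0]
      · simp [h2]
    · rw [centroidMap, if_neg hj0, centroidMap, if_pos hi] at hij
      exact hin _ (hmem j hj0) hij
  refine ⟨h0, fun i j hij ↦ ?_, fun i ↦
    levelHyperplane_sectionOffset_inter_interior_nonempty hK hKconv hne (h0 i) _, fun i j ↦ ?_⟩
  · by_contra hne'
    obtain ⟨a, ha⟩ := exists_smul_of_sectionHyperplane_eq hK hKconv hne (h0 i) (h0 j) hij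
    exact hp i j hne' a ha
  · have hij := heq i j
    rw [centroidMap, if_neg (h0 i), centroidMap, if_neg (h0 j)] at hij
    exact hinj (hmem i (h0 i)) (hmem j (h0 j)) hij

variable [PseudoMetricSpace Y] {d : ℝ}

lemma dist_centroidMap_lt_of_pos {K : Set E} (hK : IsCompact K) (hKconv : Convex ℝ K)
    (hne : (interior K).Nonempty) (hd : d + 1 = finrank ℝ E) (hd0 : 0 ≤ d) {Ψ : E → Y} {N : Y}
    (hout : ∀ x ∉ interior K, Ψ x = N) {R ε δ : ℝ} (hR : K ⊆ closedBall 0 R) (hε : 0 < ε)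
    (hδ : ∀ ⦃x y⦄, dist x y < δ → dist (Ψ x) (Ψ y) < ε) {p : E × ℝ}
    (hp : R * (1 - p.2 / (‖p.1‖ + |p.2|)) < δ) : dist (centroidMap d K Ψ N p) N < ε := by
  by_cases hu : p.1 = 0
  · simpa [centroidMap, hu] using hε
  have hu0 : 0 < ‖p.1‖ := norm_pos_iff.2 hu
  rw [centroidMap, if_neg hu]
  have hmem := (sectionCentroid_mem hK hKconv hd hd0 hu
    (levelHyperplane_sectionOffset_inter_interior_nonempty hK hKconv hne hu p.2)).1
  set x := sectionCentroid d K (sectionHyperplane K p)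
  replace hmem : ⟪x, p.1⟫ = sectionOffset K p.1 p.2 := hmem
  set b := supportFun K p.1 - sectionOffset K p.1 p.2 with hb
  set z := x + (b / ‖p.1‖ ^ 2) • p.1 with hz
  have hzK : z ∉ interior K := by
    intro h
    have := inner_lt_supportFun hK h hu
    rw [hz, inner_add_left, hmem, inner_smul_left, real_inner_self_eq_norm_sq, conj_trivial,
      div_mul_cancel₀ _ (by positivity), hb] at this
    linarith
  rw [← hout z hzK]
  refine hδ (lt_of_le_of_lt ?_ hp)
  have hsupp : ∀ w : E, supportFun K w ≤ R * ‖w‖ := fun w ↦ by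
    obtain ⟨y, hy, hyw⟩ := exists_inner_eq_supportFun hK (hne.mono interior_subset) w
    rw [← hyw]
    exact (real_inner_le_norm _ _).trans
      (mul_le_mul_of_nonneg_right (mem_closedBall_zero_iff.1 (hR hy)) (norm_nonneg _))
  have hσ := (abs_lt.1 (abs_div_norm_add_abs_lt_one hu p.2)).2
  have hw := supportFun_add_supportFun_neg_pos hK hne hu
  have h1 := hsupp p.1
  have h2 := hsupp (-p.1)
  rw [norm_neg] at h2
  have hb0 : 0 ≤ b := by
    rw [hb, supportFun_sub_sectionOffset]
    exact mul_nonneg hw.le (by linarith)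
  have hbR : b ≤ R * (1 - p.2 / (‖p.1‖ + |p.2|)) * ‖p.1‖ := by
    rw [hb, supportFun_sub_sectionOffset]
    nlinarith
  have hdist : dist x z = b / ‖p.1‖ := by
    rw [hz, dist_self_add_right, norm_smul, Real.norm_eq_abs, abs_of_nonneg (by positivity)]
    field_simp
  rw [hdist, div_le_iff₀ hu0]
  exact hbR

lemma continuousAt_centroidMap {K : Set E} (hK : IsCompact K) (hKconv : Convex ℝ K)
    (hne : (interior K).Nonempty) (hd : d + 1 = finrank ℝ E) (hd0 : 0 ≤ d) {Ψ : E → Y} {N : Y}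
    (hΨ : UniformContinuous Ψ) (hout : ∀ x ∉ interior K, Ψ x = N) {p : E × ℝ} (hp : p ≠ 0) :
    ContinuousAt (centroidMap d K Ψ N) p := by
  by_cases hu : p.1 = 0
  · have hpos : ∀ q : E × ℝ, q.1 = 0 → 0 < q.2 → ContinuousAt (centroidMap d K Ψ N) q := by
      intro q hq hq2
      rw [ContinuousAt, show centroidMap d K Ψ N q = N by simp [centroidMap, hq],
        Metric.tendsto_nhds]
      intro ε hε
      obtain ⟨δ, hδ, hδε⟩ := Metric.uniformContinuous_iff.1 hΨ ε hε
      obtain ⟨R, hR⟩ := hK.isBounded.subset_closedBall (0 : E)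
      have hq0 : ‖q.1‖ + |q.2| ≠ 0 := by positivity
      have hcont : ContinuousAt (fun r : E × ℝ ↦ R * (1 - r.2 / (‖r.1‖ + |r.2|))) q := by
        fun_prop (disch := assumption)
      have hval : R * (1 - q.2 / (‖q.1‖ + |q.2|)) < δ := by
        rw [hq, norm_zero, zero_add, abs_of_pos hq2, div_self hq2.ne']
        simpa using hδ
      exact (hcont.eventually_lt continuousAt_const hval).mono fun r hr ↦
        dist_centroidMap_lt_of_pos hK hKconv hne hd hd0 hout hR hε (fun x y h ↦ hδε h) hr
    have hp2 : p.2 ≠ 0 := fun h ↦ hp (Prod.ext hu h)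
    rcases hp2.lt_or_gt with h | h
    · have hneg : centroidMap d K Ψ N = centroidMap d K Ψ N ∘ Neg.neg := by
        ext1 q
        simpa using (centroidMap_smul d K Ψ N q (neg_ne_zero.2 one_ne_zero)).symm
      rw [hneg]
      exact (hpos (-p) (by simp [hu]) (by simpa using h)).comp continuous_neg.continuousAt
    · exact hpos p hu h
  · have hmeet := levelHyperplane_sectionOffset_inter_interior_nonempty hK hKconv hne hu p.2
    have h1 : ContinuousAt (fun q : E × ℝ ↦ sectionCentroid d K (sectionHyperplane K q)) p :=
      (continuousAt_sectionCentroid hK hKconv hd hd0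
        (p := (p.1, sectionOffset K p.1 p.2)) hu hmeet).comp
          (f := fun q : E × ℝ ↦ (q.1, sectionOffset K q.1 q.2))
          (continuousAt_fst.prodMk (continuousAt_sectionOffset hK hu))
    refine (hΨ.continuous.continuousAt.comp h1).congr ?_
    filter_upwards [continuousAt_fst.eventually_ne hu] with q hq
    simp [centroidMap, hq]

end Extension

/-- A map wrapping the unit ball of `E` around the unit sphere of `E × ℝ` and collapsing the
complement of the open unit ball to the pole `(0, 1)`. -/
noncomputable def ballToSphere (x : E) : WithLp 2 (E × ℝ) :=
  WithLp.toLp 2 ((2 * √(1 - ‖x‖ ^ 2)) • x, 2 * min 1 (‖x‖ ^ 2) - 1)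

lemma norm_ballToSphere (x : E) : ‖ballToSphere x‖ = 1 := by
  rw [← sq_eq_sq₀ (norm_nonneg _) zero_le_one, WithLp.prod_norm_sq_eq_of_L2]
  change ‖(2 * √(1 - ‖x‖ ^ 2)) • x‖ ^ 2 + ‖2 * min 1 (‖x‖ ^ 2) - 1‖ ^ 2 = 1 ^ 2
  simp only [norm_smul, mul_pow, Real.norm_eq_abs, sq_abs]
  rcases le_total (‖x‖ ^ 2) 1 with h | h
  · rw [Real.sq_sqrt (by linarith), min_eq_right h]; ring
  · rw [Real.sqrt_eq_zero_of_nonpos (by linarith), min_eq_left h]; norm_num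

lemma continuous_ballToSphere : Continuous (ballToSphere (E := E)) := by
  unfold ballToSphere
  fun_prop

lemma ballToSphere_of_one_le {x : E} (hx : 1 ≤ ‖x‖) :
    ballToSphere x = WithLp.toLp 2 (0, 1) := by
  have h : 1 ≤ ‖x‖ ^ 2 := one_le_pow₀ hx
  rw [ballToSphere, Real.sqrt_eq_zero_of_nonpos (by linarith), min_eq_left h]
  norm_num

lemma injOn_ballToSphere : InjOn (ballToSphere (E := E)) (ball 0 1) := by
  intro x hx y hy h
  rw [mem_ball_zero_iff, ← sq_lt_one_iff₀ (norm_nonneg _)] at hx hy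
  have h' := congrArg WithLp.ofLp h
  simp only [ballToSphere, Prod.mk.injEq, min_eq_right hx.le, min_eq_right hy.le] at h'
  have hxy : ‖x‖ ^ 2 = ‖y‖ ^ 2 := by linarith [h'.2]
  rw [hxy] at h'
  have h0 : 2 * √(1 - ‖y‖ ^ 2) ≠ 0 := by
    have := Real.sqrt_pos.2 (sub_pos.2 hy)
    positivity
  exact smul_right_injective E h0 h'.1

lemma ballToSphere_ne {x : E} (hx : ‖x‖ < 1) : ballToSphere x ≠ WithLp.toLp 2 (0, 1) := by
  intro h
  rw [← sq_lt_one_iff₀ (norm_nonneg _)] at hx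
  have h' := congrArg WithLp.ofLp h
  simp only [ballToSphere, Prod.mk.injEq, min_eq_right hx.le] at h'
  linarith [h'.2]

/-- The interior of a bounded convex set embeds in a sphere, with its complement collapsed to the
missing point. -/
lemma exists_collapse_to_sphere [FiniteDimensional ℝ E] {K : Set E} (hK : IsCompact K)
    (hKconv : Convex ℝ K) (hne : (interior K).Nonempty) :
    ∃ (Ψ : E → sphere (0 : WithLp 2 (E × ℝ)) 1) (N : sphere (0 : WithLp 2 (E × ℝ)) 1),
      UniformContinuous Ψ ∧ (∀ x ∉ interior K, Ψ x = N) ∧ (∀ x ∈ interior K, Ψ x ≠ N) ∧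
        InjOn Ψ (interior K) := by
  obtain ⟨h, hint, -, -⟩ :=
    exists_homeomorph_image_interior_closure_frontier_eq_unitBall hKconv hne hK.isBounded
  have hmem : ∀ x, x ∈ interior K ↔ ‖h x‖ < 1 := fun x ↦ by
    rw [← mem_ball_zero_iff, ← hint, h.injective.mem_set_image]
  let N : sphere (0 : WithLp 2 (E × ℝ)) 1 :=
    ⟨WithLp.toLp 2 (0, 1), by simp⟩
  let Ψ : E → sphere (0 : WithLp 2 (E × ℝ)) 1 := fun x ↦
    ⟨ballToSphere (h x), by simp [norm_ballToSphere]⟩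
  have hout : ∀ x ∉ interior K, Ψ x = N := fun x hx ↦
    Subtype.ext (ballToSphere_of_one_le (not_lt.1 ((hmem x).not.1 hx)))
  have hcont : Continuous Ψ := (continuous_ballToSphere.comp h.continuous).subtype_mk _
  refine ⟨Ψ, N, ?_, hout, fun x hx hxN ↦ ?_, fun x hx y hy hxy ↦ ?_⟩
  · refine hcont.uniformContinuous_of_tendsto_cocompact (x := N) (tendsto_const_nhds.congr' ?_)
    filter_upwards [hK.compl_mem_cocompact] with x hx
    exact (hout x fun h ↦ hx (interior_subset h)).symm
  · exact ballToSphere_ne ((hmem x).1 hx) (congrArg Subtype.val hxN)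
  · exact h.injective (injOn_ballToSphere (mem_ball_zero_iff.2 ((hmem x).1 hx))
      (mem_ball_zero_iff.2 ((hmem y).1 hy)) (congrArg Subtype.val hxy))

end HyperplaneSections

/-- For a convex body `K ⊆ ℝ^m` there is a continuous map `f : ℝP^m → S^m` such that
any `k`-multiplicity of `f` yields `k` pairwise distinct affine hyperplanes meeting
the interior of `K` whose centers of mass (of the sections of `K`) coincide. -/
theorem exists_map_hyperplane_sections_of_convexBody
    (m : ℕ) (hm : 2 ≤ m) (K : Set (EuclideanSpace ℝ (Fin m)))
    (hKcomp : IsCompact K) (hKconv : Convex ℝ K) (hKint : (interior K).Nonempty) :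
    ∃ f : Projectivization ℝ (EuclideanSpace ℝ (Fin (m + 1))) →
        Metric.sphere (0 : EuclideanSpace ℝ (Fin (m + 1))) 1,
      Continuous f ∧
        ∀ k : ℕ, 2 ≤ k →
          (∃ x : Fin k → Projectivization ℝ (EuclideanSpace ℝ (Fin (m + 1))),
            Function.Injective x ∧ ∀ i j, f (x i) = f (x j)) →
          ∃ H : Fin k → Set (EuclideanSpace ℝ (Fin m)),
            Function.Injective H ∧
              (∀ i, IsAffineHyperplane (H i)) ∧
              (∀ i, (H i ∩ interior K).Nonempty) ∧
              ∀ i j, centerOfMass m K (H i) = centerOfMass m K (H j) := by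
  have hfin : (m : ℝ) - 1 + 1 = finrank ℝ (EuclideanSpace ℝ (Fin m)) := by simp
  have hd0 : (0 : ℝ) ≤ (m : ℝ) - 1 := by
    have : (2 : ℝ) ≤ m := by exact_mod_cast hm
    linarith
  have hW : finrank ℝ (WithLp 2 (EuclideanSpace ℝ (Fin m) × ℝ)) = m + 1 := by
    rw [(WithLp.linearEquiv 2 ℝ (EuclideanSpace ℝ (Fin m) × ℝ)).finrank_eq]
    simp
  let e : WithLp 2 (EuclideanSpace ℝ (Fin m) × ℝ) ≃ₗᵢ[ℝ] EuclideanSpace ℝ (Fin (m + 1)) :=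
    ((stdOrthonormalBasis ℝ _).reindex (finCongr hW)).repr
  let L : EuclideanSpace ℝ (Fin (m + 1)) ≃L[ℝ] EuclideanSpace ℝ (Fin m) × ℝ :=
    e.symm.toContinuousLinearEquiv.trans (WithLp.prodContinuousLinearEquiv 2 ℝ _ _)
  let ι : sphere (0 : WithLp 2 (EuclideanSpace ℝ (Fin m) × ℝ)) 1 →
      sphere (0 : EuclideanSpace ℝ (Fin (m + 1))) 1 := fun x ↦ ⟨e x, by simp⟩
  have hι : Continuous ι := (e.continuous.comp continuous_subtype_val).subtype_mk _
  have hι_inj : Function.Injective ι := fun x y h ↦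
    Subtype.ext (e.injective (congrArg Subtype.val h))
  obtain ⟨Ψ, N, hΨ, hout, hin, hinj⟩ := exists_collapse_to_sphere hKcomp hKconv hKint
  let F := centroidMap ((m : ℝ) - 1) K Ψ N
  have hF : ∀ (a : ℝ) (_ : a ≠ 0) (v : EuclideanSpace ℝ (Fin (m + 1))), F (L (a • v)) = F (L v) :=
    fun a ha v ↦ by rw [map_smul]; exact centroidMap_smul _ _ _ _ _ ha
  let g : {v : EuclideanSpace ℝ (Fin (m + 1)) // v ≠ 0} →
    sphere (0 : EuclideanSpace ℝ (Fin (m + 1))) 1 := fun v ↦ ι (F (L v))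
  have hg : Continuous g := by
    refine hι.comp (continuous_iff_continuousAt.2 fun v ↦ ?_)
    exact ContinuousAt.comp (f := fun v : {v : EuclideanSpace ℝ (Fin (m + 1)) // v ≠ 0} ↦ L v)
      (continuousAt_centroidMap hKcomp hKconv hKint hfin hd0 hΨ hout
        ((map_ne_zero_iff L L.injective).2 v.2))
      (L.continuous.comp continuous_subtype_val).continuousAt
  have hg_smul : ∀ (v w : {v : EuclideanSpace ℝ (Fin (m + 1)) // v ≠ 0}) (t : ℝ),
      v = t • (w : EuclideanSpace ℝ (Fin (m + 1))) → g v = g w := by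
    intro v w t h
    have ht : t ≠ 0 := by rintro rfl; exact v.2 (by rw [h, zero_smul])
    simp only [g, h, hF t ht]
  refine ⟨Projectivization.lift g hg_smul, continuous_quot_lift _ hg, ?_⟩
  rintro k hk ⟨x, hx, hfx⟩
  have : Nontrivial (Fin k) := Fin.nontrivial_iff_two_le.2 hk
  have hlift : ∀ i, Projectivization.lift g hg_smul (x i) = ι (F (L (x i).rep)) := fun i ↦ by
    conv_lhs => rw [← (x i).mk_rep]
    rfl
  have hp : ∀ i j, i ≠ j → ∀ a : ℝ, a • L (x i).rep ≠ L (x j).rep := fun i j hij a ha ↦ by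
    rw [← map_smul] at ha
    refine hij (hx ?_)
    rw [← (x i).mk_rep, ← (x j).mk_rep, eq_comm, Projectivization.mk_eq_mk_iff']
    exact ⟨a, L.injective ha⟩
  obtain ⟨h0, hHinj, hHint, hHeq⟩ := exists_hyperplanes_of_centroidMap_eq hKcomp hKconv hKint
    hfin hd0 hin hinj hp (fun i ↦ (map_ne_zero_iff L L.injective).2 (x i).rep_nonzero)
    (fun i j ↦ hι_inj (by rw [← hlift, ← hlift, hfx i j]))
  exact ⟨_, hHinj, fun i ↦ ⟨_, h0 i, _, rfl⟩, hHint, hHeq⟩
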